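/- The center of U(sl2 ⋉ V) (the case z = 0 of the infinitesimal Hecke algebra) is the polynomial algebra C[t] where t = ey² + hxy − fx². -/

import Mathlib

noncomputable section

open Polynomial

/-- Free algebra on generators e, h, f, x, y. -/
abbrev F5 : Type := FreeAlgebra ℂ (Fin 5)

def ge : F5 := FreeAlgebra.ι ℂ 0
def gh : F5 := FreeAlgebra.ι ℂ 1
def gf : F5 := FreeAlgebra.ι ℂ 2
def gx : F5 := FreeAlgebra.ι ℂ 3
def gy : F5 := FreeAlgebra.ι ℂ 4

/-- The shifted Casimir element Δ = h² + 4ef − 2h (as a word in the free algebra). -/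
def gΔ : F5 := gh * gh + 4 * (ge * gf) - 2 * gh

/-- Defining relations of the infinitesimal Hecke algebra H_z of sl₂:
sl₂ relations, the standard action on V = span(x,y), and [x,y] = z. -/
inductive HRel (z : F5) : F5 → F5 → Prop
  | he : HRel z (gh * ge) (ge * gh + 2 * ge)
  | hf : HRel z (gh * gf) (gf * gh - 2 * gf)
  | ef : HRel z (ge * gf) (gf * ge + gh)
  | ex : HRel z (ge * gx) (gx * ge)
  | ey : HRel z (ge * gy) (gy * ge + gx)
  | fx : HRel z (gf * gx) (gx * gf + gy)
  | fy : HRel z (gf * gy) (gy * gf)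
  | hx : HRel z (gh * gx) (gx * gh + gx)
  | hy : HRel z (gh * gy) (gy * gh - gy)
  | xy : HRel z (gx * gy) (gy * gx + z)

/-- The infinitesimal Hecke algebra H_z (for z = 0 this is U(sl₂ ⋉ V)). -/
abbrev Hz (z : F5) : Type := RingQuot (HRel z)

/-- Canonical projection from the free algebra. -/
def π (z : F5) : F5 →ₐ[ℂ] Hz z := RingQuot.mkAlgHom ℂ (HRel z)


/-! ### Relations and a representation -/

lemma pi_rel {a b : F5} (h : HRel 0 a b) : π 0 a = π 0 b := RingQuot.mkAlgHom_rel ℂ h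

lemma pi_two : π 0 (2 : F5) = (2 : Hz 0) := by
  rw [show (2 : F5) = 1 + 1 from one_add_one_eq_two.symm, map_add, map_one, one_add_one_eq_two]

lemma neg_sm (c : ℂ) (z : Hz 0) : (-c) • z = -(c • z) := by
  apply eq_neg_of_add_eq_zero_left
  rw [← add_smul]; simp

lemma r_he : π 0 gh * π 0 ge = π 0 ge * π 0 gh + 2 * π 0 ge := by
  simpa [pi_two] using pi_rel HRel.he
lemma r_hf : π 0 gh * π 0 gf = π 0 gf * π 0 gh - 2 * π 0 gf := by
  simpa [pi_two] using pi_rel HRel.hf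
lemma r_ef : π 0 ge * π 0 gf = π 0 gf * π 0 ge + π 0 gh := by
  simpa using pi_rel HRel.ef
lemma r_ex : π 0 ge * π 0 gx = π 0 gx * π 0 ge := by
  simpa using pi_rel HRel.ex
lemma r_ey : π 0 ge * π 0 gy = π 0 gy * π 0 ge + π 0 gx := by
  simpa using pi_rel HRel.ey
lemma r_fx : π 0 gf * π 0 gx = π 0 gx * π 0 gf + π 0 gy := by
  simpa using pi_rel HRel.fx
lemma r_fy : π 0 gf * π 0 gy = π 0 gy * π 0 gf := by
  simpa using pi_rel HRel.fy
lemma r_hx : π 0 gh * π 0 gx = π 0 gx * π 0 gh + π 0 gx := by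
  simpa using pi_rel HRel.hx
lemma r_hy : π 0 gh * π 0 gy = π 0 gy * π 0 gh - π 0 gy := by
  simpa using pi_rel HRel.hy
lemma r_xy : π 0 gx * π 0 gy = π 0 gy * π 0 gx := by
  simpa using pi_rel HRel.xy

/-- The central element. -/
def tt : Hz 0 := π 0 ge * π 0 gy ^ 2 + π 0 gh * π 0 gx * π 0 gy - π 0 gf * π 0 gx ^ 2

/-- A subalgebra containing the generators is everything. -/
lemma gen_top (S : Subalgebra ℂ (Hz 0)) (he : π 0 ge ∈ S) (hh : π 0 gh ∈ S)
    (hf : π 0 gf ∈ S) (hx : π 0 gx ∈ S) (hy : π 0 gy ∈ S) (a : Hz 0) : a ∈ S := by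
  obtain ⟨b, rfl⟩ := RingQuot.mkAlgHom_surjective ℂ (HRel 0) a
  change π 0 b ∈ S
  induction b using FreeAlgebra.induction with
  | grade0 r => rw [AlgHom.commutes]; exact S.algebraMap_mem r
  | grade1 i => fin_cases i <;> assumption
  | mul a b ha hb => rw [map_mul]; exact S.mul_mem ha hb
  | add a b ha hb => rw [map_add]; exact S.add_mem ha hb

lemma gen_top_submodule (S : Submodule ℂ (Hz 0)) (h1 : 1 ∈ S)
    (he : ∀ s ∈ S, π 0 ge * s ∈ S) (hh : ∀ s ∈ S, π 0 gh * s ∈ S)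
    (hf : ∀ s ∈ S, π 0 gf * s ∈ S) (hx : ∀ s ∈ S, π 0 gx * s ∈ S)
    (hy : ∀ s ∈ S, π 0 gy * s ∈ S) (a : Hz 0) : a ∈ S := by
  let T : Subalgebra ℂ (Hz 0) :=
    { carrier := {a | ∀ s ∈ S, a * s ∈ S}
      mul_mem' := fun {a b} ha hb s hs => by rw [mul_assoc]; exact ha _ (hb _ hs)
      add_mem' := fun {a b} ha hb s hs => by rw [add_mul]; exact S.add_mem (ha _ hs) (hb _ hs)
      algebraMap_mem' := fun r s hs => by
        rw [← Algebra.smul_def]; exact S.smul_mem r hs }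
  have : a ∈ T := gen_top T he hh hf hx hy a
  simpa using this 1 h1

lemma ra {a b c : Hz 0} (h : a * b = c) (d : Hz 0) : a * (b * d) = c * d := by
  rw [← mul_assoc, h]

lemma tt_comm (a : Hz 0) : a * tt = tt * a := by
  have key : a ∈ Subalgebra.centralizer ℂ ({tt} : Set (Hz 0)) := by
    apply gen_top <;> rw [Subalgebra.mem_centralizer_iff] <;> rintro _ rfl <;>
    · simp only [tt, pow_two, mul_add, add_mul, mul_sub, sub_mul, mul_assoc, two_mul,
        r_he, r_hf, r_ef, r_ex, r_ey, r_fx, r_fy, r_hx, r_hy, r_xy,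
        ra r_he, ra r_hf, ra r_ef, ra r_ex, ra r_ey, ra r_fx, ra r_fy, ra r_hx, ra r_hy, ra r_xy]
      abel
  rw [Subalgebra.mem_centralizer_iff] at key
  exact (key tt rfl).symm

/-- The representation space: formal functions on `ℤ × ℤ` (exponents of `x`, `y`). -/
abbrev MM : Type := ℤ → ℤ → ℂ[X]

def oE : Module.End ℂ MM where
  toFun g := fun m n => ((n + 1 : ℤ) : ℂ[X]) * g (m - 1) (n + 1)
  map_add' g k := by ext1 m; ext1 n; simp [mul_add]
  map_smul' c g := by ext1 m; ext1 n; simp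
def oH : Module.End ℂ MM where
  toFun g := fun m n => ((m - n : ℤ) : ℂ[X]) * g m n
  map_add' g k := by ext1 m; ext1 n; simp [mul_add]
  map_smul' c g := by ext1 m; ext1 n; simp
def oF : Module.End ℂ MM where
  toFun g := fun m n => ((m + 1 : ℤ) : ℂ[X]) * g (m + 1) (n - 1) - X * g (m + 2) n
  map_add' g k := by ext1 m; ext1 n; simp [mul_add]; ring
  map_smul' c g := by ext1 m; ext1 n; simp [smul_sub]
def oX : Module.End ℂ MM where
  toFun g := fun m n => g (m - 1) n
  map_add' g k := by ext1 m; ext1 n; simp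
  map_smul' c g := by ext1 m; ext1 n; simp
def oY : Module.End ℂ MM where
  toFun g := fun m n => g m (n - 1)
  map_add' g k := by ext1 m; ext1 n; simp
  map_smul' c g := by ext1 m; ext1 n; simp

lemma oE_apply (g : MM) (m n : ℤ) :
    oE g m n = ((n + 1 : ℤ) : ℂ[X]) * g (m - 1) (n + 1) := rfl
lemma oH_apply (g : MM) (m n : ℤ) : oH g m n = ((m - n : ℤ) : ℂ[X]) * g m n := rfl
lemma oF_apply (g : MM) (m n : ℤ) :
    oF g m n = ((m + 1 : ℤ) : ℂ[X]) * g (m + 1) (n - 1) - X * g (m + 2) n := rfl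
lemma oX_apply (g : MM) (m n : ℤ) : oX g m n = g (m - 1) n := rfl
lemma oY_apply (g : MM) (m n : ℤ) : oY g m n = g m (n - 1) := rfl

def ρ0 : F5 →ₐ[ℂ] Module.End ℂ MM := FreeAlgebra.lift ℂ ![oE, oH, oF, oX, oY]

lemma ρ0_e : ρ0 ge = oE := by simp [ρ0, ge]
lemma ρ0_h : ρ0 gh = oH := by simp [ρ0, gh]
lemma ρ0_f : ρ0 gf = oF := by simp [ρ0, gf]
lemma ρ0_x : ρ0 gx = oX := by simp [ρ0, gx]
lemma ρ0_y : ρ0 gy = oY := by simp [ρ0, gy]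

lemma ρ0_rel ⦃a b : F5⦄ (h : HRel 0 a b) : ρ0 a = ρ0 b := by
  cases h <;>
  · simp only [map_mul, map_add, map_sub, map_zero, two_mul, ρ0_e, ρ0_h, ρ0_f, ρ0_x, ρ0_y]
    refine LinearMap.ext fun g => ?_
    ext1 m; ext1 n
    simp only [Module.End.mul_apply, LinearMap.add_apply, LinearMap.sub_apply, Pi.add_apply,
      Pi.sub_apply, oE_apply, oH_apply, oF_apply, oX_apply, oY_apply, LinearMap.zero_apply,
      Pi.zero_apply]
    try ring_nf
    try (push_cast; ring_nf)

def ρ : Hz 0 →ₐ[ℂ] Module.End ℂ MM := RingQuot.liftAlgHom ℂ ⟨ρ0, ρ0_rel⟩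

lemma ρ_π (a : F5) : ρ (π 0 a) = ρ0 a := by simp [ρ, π]

lemma ρ_e : ρ (π 0 ge) = oE := by rw [ρ_π, ρ0_e]
lemma ρ_h : ρ (π 0 gh) = oH := by rw [ρ_π, ρ0_h]
lemma ρ_f : ρ (π 0 gf) = oF := by rw [ρ_π, ρ0_f]
lemma ρ_x : ρ (π 0 gx) = oX := by rw [ρ_π, ρ0_x]
lemma ρ_y : ρ (π 0 gy) = oY := by rw [ρ_π, ρ0_y]

lemma ρ_tt_apply (g : MM) (m n : ℤ) : ρ tt g m n = X * g m n := by
  simp only [tt, map_add, map_sub, map_mul, pow_two, ρ_e, ρ_h, ρ_f, ρ_x, ρ_y,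
    Module.End.mul_apply, LinearMap.add_apply, LinearMap.sub_apply, Pi.add_apply,
      Pi.sub_apply, oE_apply, oH_apply, oF_apply, oX_apply, oY_apply]
  ring_nf
  push_cast
  ring_nf

lemma ρ_aeval_apply (p : ℂ[X]) (g : MM) (m n : ℤ) :
    ρ (aeval tt p) g m n = p * g m n := by
  induction p using Polynomial.induction_on' generalizing g with
  | add p q hp hq => simp [hp, hq, add_mul]
  | monomial k a =>
    have h : ∀ k : ℕ, (ρ tt ^ k) g m n = X ^ k * g m n := by
      intro k
      induction k with
      | zero => simp
      | succ k ih => rw [pow_succ', Module.End.mul_apply, ρ_tt_apply, ih]; ring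
    rw [aeval_monomial, map_mul, AlgHom.commutes, map_pow, Module.End.mul_apply,
      Module.algebraMap_end_apply, Pi.smul_apply, Pi.smul_apply, h, ← C_mul_X_pow_eq_monomial,
      smul_eq_C_mul, mul_assoc]

/-- Delta functions. -/
def dl (m n : ℤ) : MM := fun u v => if u = m ∧ v = n then 1 else 0

lemma dl_apply (m n u v : ℤ) : dl m n u v = if u = m ∧ v = n then 1 else 0 := rfl

/-! ### Spanning -/

def mon (i j c : ℕ) (q : ℂ[X]) (a : ℕ) : Hz 0 :=
  π 0 gx ^ i * (π 0 gy ^ j * (π 0 gf ^ c * (aeval (π 0 gh) q * π 0 ge ^ a)))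

/-- `mon` as a linear map in the polynomial. -/
def monL (k : ℕ × ℕ × ℕ × ℕ) : ℂ[X] →ₗ[ℂ] Hz 0 where
  toFun := fun q => mon k.1 k.2.1 k.2.2.1 q k.2.2.2
  map_add' := fun p q => by simp [mon, add_mul, mul_add]
  map_smul' := fun c q => by simp [mon]

lemma monL_apply (k : ℕ × ℕ × ℕ × ℕ) (q : ℂ[X]) :
    monL k q = mon k.1 k.2.1 k.2.2.1 q k.2.2.2 := rfl

/-- Linear map from normal forms. -/
def ψ : ((ℕ × ℕ × ℕ × ℕ) →₀ ℂ[X]) →ₗ[ℂ] Hz 0 :=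
  Finsupp.lsum ℂ monL

lemma ψ_single (k : ℕ × ℕ × ℕ × ℕ) (q : ℂ[X]) :
    ψ (Finsupp.single k q) = mon k.1 k.2.1 k.2.2.1 q k.2.2.2 := by
  rw [← monL_apply]; simp [ψ]

lemma mon_mem (i j c : ℕ) (q : ℂ[X]) (a : ℕ) : mon i j c q a ∈ LinearMap.range ψ :=
  ⟨Finsupp.single (i, j, c, a) q, ψ_single _ _⟩

lemma e_y (j : ℕ) : π 0 ge * π 0 gy ^ j =
    π 0 gy ^ j * π 0 ge + (j : ℂ) • (π 0 gx * π 0 gy ^ (j - 1)) := by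
  induction j with
  | zero => simp
  | succ j ih =>
    have hc : π 0 gx * π 0 gy ^ j = π 0 gy ^ j * π 0 gx :=
      (Commute.pow_right (show Commute (π 0 gx) (π 0 gy) from r_xy) j).eq
    have hj : (j : ℂ) • (π 0 gx * π 0 gy ^ (j - 1)) * π 0 gy =
        (j : ℂ) • (π 0 gx * π 0 gy ^ j) := by
      cases j with
      | zero => simp
      | succ j => simp [pow_succ, mul_assoc]
    rw [pow_succ, ← mul_assoc, ih, add_mul, hj, mul_assoc, r_ey, mul_add]
    simp only [Nat.add_sub_cancel, Nat.cast_succ, add_smul, one_smul, hc, mul_assoc]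
    abel

lemma e_x (i : ℕ) : π 0 ge * π 0 gx ^ i = π 0 gx ^ i * π 0 ge :=
  (Commute.pow_right (show Commute (π 0 ge) (π 0 gx) from r_ex) i).eq

lemma f_y (i : ℕ) : π 0 gf * π 0 gy ^ i = π 0 gy ^ i * π 0 gf :=
  (Commute.pow_right (show Commute (π 0 gf) (π 0 gy) from r_fy) i).eq

lemma y_x (i : ℕ) : π 0 gy * π 0 gx ^ i = π 0 gx ^ i * π 0 gy :=
  (Commute.pow_right (show Commute (π 0 gy) (π 0 gx) from r_xy.symm) i).eq

lemma f_x (j : ℕ) : π 0 gf * π 0 gx ^ j =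
    π 0 gx ^ j * π 0 gf + (j : ℂ) • (π 0 gx ^ (j - 1) * π 0 gy) := by
  induction j with
  | zero => simp
  | succ j ih =>
    have hj : (j : ℂ) • (π 0 gx ^ (j - 1) * π 0 gy) * π 0 gx =
        (j : ℂ) • (π 0 gx ^ j * π 0 gy) := by
      cases j with
      | zero => simp
      | succ j => simp [pow_succ, mul_assoc, r_xy]
    rw [pow_succ, ← mul_assoc, ih, add_mul, hj, mul_assoc, r_fx, mul_add]
    simp only [Nat.add_sub_cancel, Nat.cast_succ, add_smul, one_smul, mul_assoc]
    abel

lemma h_pow (z : Hz 0) (c : ℂ) (h : π 0 gh * z = z * π 0 gh + c • z) (k : ℕ) :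
    π 0 gh * z ^ k = z ^ k * π 0 gh + (k * c) • z ^ k := by
  induction k with
  | zero => simp
  | succ k ih =>
    rw [pow_succ, ← mul_assoc, ih, add_mul, mul_assoc, h]
    simp only [mul_add, Nat.cast_succ, add_mul, one_mul, add_smul, mul_assoc, mul_smul_comm,
      smul_mul_assoc]
    abel

lemma h_x (k : ℕ) : π 0 gh * π 0 gx ^ k = π 0 gx ^ k * π 0 gh + (k * 1 : ℂ) • π 0 gx ^ k :=
  h_pow _ _ (by rw [r_hx, one_smul]) k
lemma h_y (k : ℕ) : π 0 gh * π 0 gy ^ k = π 0 gy ^ k * π 0 gh + (k * (-1) : ℂ) • π 0 gy ^ k :=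
  h_pow _ _ (by rw [r_hy, neg_sm, one_smul, sub_eq_add_neg]) k
lemma h_f (k : ℕ) : π 0 gh * π 0 gf ^ k = π 0 gf ^ k * π 0 gh + (k * (-2) : ℂ) • π 0 gf ^ k :=
  h_pow _ _ (by rw [r_hf, neg_sm, two_smul, sub_eq_add_neg, two_mul]) k

lemma e_q (q : ℂ[X]) : π 0 ge * aeval (π 0 gh) q =
    aeval (π 0 gh) (q.comp (X - C 2)) * π 0 ge := by
  have h1 : π 0 ge * π 0 gh = (π 0 gh - 2) * π 0 ge := by
    rw [sub_mul, r_he]; abel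
  induction q using Polynomial.induction_on' with
  | add p q hp hq => simp only [map_add, mul_add, add_comp, add_mul, hp, hq]
  | monomial k a =>
    have h : π 0 ge * π 0 gh ^ k = (π 0 gh - 2) ^ k * π 0 ge := by
      induction k with
      | zero => simp
      | succ k ih => rw [pow_succ, ← mul_assoc, ih, mul_assoc, h1, pow_succ, mul_assoc]
    have h2 : algebraMap ℂ (Hz 0) 2 = 2 := map_ofNat _ 2
    rw [← C_mul_X_pow_eq_monomial]
    simp only [map_mul, map_pow, aeval_X, aeval_C, mul_comp, C_comp, pow_comp, X_comp, map_sub, h2]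
    rw [mul_assoc, ← h, ← mul_assoc, ← mul_assoc, Algebra.commutes]

lemma e_f (c : ℕ) : π 0 ge * π 0 gf ^ c = π 0 gf ^ c * π 0 ge +
    π 0 gf ^ (c - 1) * aeval (π 0 gh) (C (c : ℂ) * (X - C ((c : ℂ) - 1))) := by
  induction c with
  | zero => simp
  | succ c ih =>
    have hj : π 0 gf ^ (c - 1) * aeval (π 0 gh) (C (c : ℂ) * (X - C ((c : ℂ) - 1))) * π 0 gf =
        π 0 gf ^ c * aeval (π 0 gh) (C (c : ℂ) * (X - C ((c : ℂ) + 1))) := by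
      cases c with
      | zero => simp
      | succ c =>
        simp only [map_mul, map_sub, aeval_X, aeval_C, ← Algebra.smul_def, Nat.add_sub_cancel,
          pow_succ, mul_smul_comm, smul_mul_assoc, mul_assoc, sub_mul, r_hf]
        congr 2
        simp only [Algebra.algebraMap_eq_smul_one, mul_sub, smul_mul_assoc, one_mul,
          mul_smul_comm, mul_one, add_smul, sub_smul, one_smul, Nat.cast_succ, two_mul, mul_add]
        abel
    rw [pow_succ, ← mul_assoc, ih, add_mul, hj, mul_assoc, r_ef, mul_add, add_assoc,
      ← mul_assoc]
    congr 1
    rw [Nat.add_sub_cancel, ← mul_add]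
    congr 1
    simp only [map_mul, map_sub, aeval_X, aeval_C, ← Algebra.smul_def, Nat.cast_succ, 
      Algebra.algebraMap_eq_smul_one, smul_sub, smul_smul, add_smul, sub_smul, one_smul, 
      add_sub_cancel_right]
    generalize (c : ℂ) • (1 : Hz 0) = d
    simp only [mul_sub, mul_add, add_mul, mul_one, one_mul]
    abel

lemma gen_stable (g : Hz 0)
    (h : ∀ i j c q a, g * mon i j c q a ∈ LinearMap.range ψ) (s : Hz 0)
    (hs : s ∈ LinearMap.range ψ) : g * s ∈ LinearMap.range ψ := by
  obtain ⟨G, rfl⟩ := hs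
  induction G using Finsupp.induction_linear with
  | zero => simp
  | add p q hp hq => rw [map_add, mul_add]; exact Submodule.add_mem _ hp hq
  | single k q => 
    have := h k.1 k.2.1 k.2.2.1 q k.2.2.2
    rwa [ψ_single]

lemma ψ_surj (a : Hz 0) : a ∈ LinearMap.range ψ := by
  apply gen_top_submodule
  · simpa [mon] using mon_mem 0 0 0 1 0
  · refine gen_stable _ fun i j c q a => ?_
    have : π 0 ge * mon i j c q a =
        mon i j c (q.comp (X - C 2)) (a + 1)
        + mon i j (c - 1) (C (c : ℂ) * (X - C ((c : ℂ) - 1)) * q) a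
        + (j : ℂ) • mon (i + 1) (j - 1) c q a := by
      simp only [mon]
      rw [ra (e_x i), mul_assoc, ra (e_y j), add_mul, mul_assoc, ra (e_f c), add_mul, mul_assoc,
        ra (e_q q), mul_assoc, ← pow_succ']
      simp only [mul_add, smul_mul_assoc, mul_smul_comm, pow_succ (π 0 gx), mul_assoc, map_mul]
    rw [this]
    exact Submodule.add_mem _ (Submodule.add_mem _ (mon_mem ..) (mon_mem ..))
      (Submodule.smul_mem _ _ (mon_mem ..))
  · refine gen_stable _ fun i j c q a => ?_
    have : π 0 gh * mon i j c q a =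
        mon i j c (X * q) a + (c * (-2) : ℂ) • mon i j c q a
        + (j * (-1) : ℂ) • mon i j c q a + (i * 1 : ℂ) • mon i j c q a := by
      simp only [mon]
      rw [ra (h_x i), add_mul, mul_assoc, ra (h_y j), add_mul, mul_assoc, ra (h_f c), add_mul,
        mul_assoc]
      simp only [mul_add, smul_mul_assoc, mul_smul_comm, mul_assoc, map_mul, aeval_X]
    rw [this]
    exact Submodule.add_mem _ (Submodule.add_mem _ (Submodule.add_mem _ (mon_mem ..)
      (Submodule.smul_mem _ _ (mon_mem ..)))
      (Submodule.smul_mem _ _ (mon_mem ..))) (Submodule.smul_mem _ _ (mon_mem ..))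
  · refine gen_stable _ fun i j c q a => ?_
    have : π 0 gf * mon i j c q a =
        mon i j (c + 1) q a + (i : ℂ) • mon (i - 1) (j + 1) c q a := by
      simp only [mon]
      rw [ra (f_x i), add_mul, mul_assoc, ra (f_y j)]
      simp only [smul_mul_assoc, mul_assoc, pow_succ']
    rw [this]
    exact Submodule.add_mem _ (mon_mem ..) (Submodule.smul_mem _ _ (mon_mem ..))
  · refine gen_stable _ fun i j c q a => ?_
    have : π 0 gx * mon i j c q a = mon (i + 1) j c q a := by
      simp only [mon, pow_succ', mul_assoc]
    rw [this]; exact mon_mem ..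
  · refine gen_stable _ fun i j c q a => ?_
    have : π 0 gy * mon i j c q a = mon i (j + 1) c q a := by
      simp only [mon]
      rw [ra (y_x i)]
      simp only [pow_succ', mul_assoc]
    rw [this]; exact mon_mem ..

/-! ### Faithfulness -/

lemma oX_pow (i : ℕ) (g : MM) (u v : ℤ) : (oX ^ i) g u v = g (u - i) v := by
  induction i generalizing u with
  | zero => simp
  | succ i ih =>
    rw [pow_succ', Module.End.mul_apply, oX_apply, ih]; congr 1; push_cast; ring

lemma oY_pow (i : ℕ) (g : MM) (u v : ℤ) : (oY ^ i) g u v = g u (v - i) := by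
  induction i generalizing v with
  | zero => simp
  | succ i ih =>
    rw [pow_succ', Module.End.mul_apply, oY_apply, ih]; congr 1; push_cast; ring

lemma oE_dl (m n : ℤ) : oE (dl m n) = (n : ℂ) • dl (m + 1) (n - 1) := by
  ext1 u; ext1 v
  rw [oE_apply, Pi.smul_apply, Pi.smul_apply, dl_apply, dl_apply]
  by_cases h : u = m + 1 ∧ v = n - 1
  · obtain ⟨rfl, rfl⟩ := h
    simp [smul_eq_C_mul]
  · rw [if_neg h, if_neg (by omega)]; simp

lemma oE_pow_dl (a : ℕ) (m : ℤ) (n : ℕ) :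
    (oE ^ a) (dl m n) = (n.descFactorial a : ℂ) • dl (m + a) (n - a) := by
  induction a with
  | zero => simp
  | succ a ih =>
    rw [pow_succ', Module.End.mul_apply, ih, map_smul, oE_dl, smul_smul, Nat.descFactorial_succ]
    rcases le_or_gt a n with h | h
    · congr 1
      · push_cast [h]; ring
      · congr 1 <;> push_cast <;> ring
    · rw [Nat.descFactorial_of_lt h]; simp

lemma oH_dl (q : ℂ[X]) (m n : ℤ) :
    (aeval oH q) (dl m n) = (q.eval ((m - n : ℤ) : ℂ)) • dl m n := by
  have h1 : oH (dl m n) = ((m - n : ℤ) : ℂ) • dl m n := by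
    ext1 u; ext1 v
    rw [oH_apply, Pi.smul_apply, Pi.smul_apply, dl_apply]
    by_cases h : u = m ∧ v = n
    · obtain ⟨rfl, rfl⟩ := h
      simp [smul_eq_C_mul]
    · rw [if_neg h]; simp
  refine Module.End.aeval_apply_of_hasEigenvector ⟨Module.End.mem_eigenspace_iff.2 h1, ?_⟩
  intro h0
  have := congrFun (congrFun h0 m) n
  simp [dl_apply] at this

lemma oF_pow (c : ℕ) (g : MM) (hg : ∀ u v, (g u v).natDegree ≤ 0) (u v : ℤ) :
    ((oF ^ c) g u v).natDegree ≤ c ∧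
    ((oF ^ c) g u v).coeff c = (-1) ^ c * (g (u + 2 * c) v).coeff 0 := by
  induction c generalizing u v with
  | zero => simpa using hg u v
  | succ c ih =>
    rw [pow_succ', Module.End.mul_apply, oF_apply]
    constructor
    · refine (natDegree_sub_le _ _).trans (max_le ?_ ?_)
      · refine natDegree_mul_le.trans ?_
        rw [natDegree_intCast, zero_add]
        exact (ih _ _).1.trans (Nat.le_succ _)
      · refine natDegree_mul_le.trans ?_
        rw [natDegree_X]
        have := (ih (u + 2) v).1
        omega
    · rw [coeff_sub, coeff_X_mul, (ih _ _).2, coeff_eq_zero_of_natDegree_lt]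
      · rw [show u + 2 + 2 * (c : ℤ) = u + 2 * ((c + 1 : ℕ) : ℤ) by push_cast; ring]
        ring
      · refine Nat.lt_succ_of_le (natDegree_mul_le.trans ?_)
        rw [natDegree_intCast, zero_add]
        exact (ih _ _).1

lemma dl_deg (m n u v : ℤ) : (dl m n u v).natDegree ≤ 0 := by
  rw [dl_apply]; split_ifs <;> simp

lemma mon_act (i j c : ℕ) (q : ℂ[X]) (a : ℕ) (m : ℤ) (n : ℕ) (u v : ℤ) :
    ρ (mon i j c q a) (dl m n) u v =
      ((n.descFactorial a : ℂ) * q.eval ((m - n + 2 * a : ℤ) : ℂ)) •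
        (oF ^ c) (dl (m + a) (n - a)) (u - i) (v - j) := by
  have h : ρ (aeval (π 0 gh) q) = aeval oH q := by rw [← aeval_algHom_apply, ρ_h]
  simp only [mon, map_mul, map_pow, ρ_e, ρ_f, ρ_x, ρ_y, h, Module.End.mul_apply, oE_pow_dl,
    map_smul, oH_dl, Pi.smul_apply, oX_pow, oY_pow, smul_smul]
  congr 4
  push_cast; ring

lemma faithful (w : Hz 0) (hw : ∀ m n : ℤ, ρ w (dl m n) = 0) : w = 0 := by
  obtain ⟨G, rfl⟩ := ψ_surj w
  by_contra hne
  have hG : G ≠ 0 := by rintro rfl; simp at hne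
  have hs : G.support.Nonempty := Finsupp.support_nonempty_iff.mpr hG
  obtain ⟨k0, hk0, hmax⟩ := G.support.exists_max_image (fun k => k.2.2.1) hs
  set c0 := k0.2.2.1 with hc0
  obtain ⟨⟨i, j, c, a⟩, hk1, hmin⟩ :=
    (G.support.filter (fun k => k.2.2.1 = c0)).exists_min_image (fun k => k.2.2.2)
      ⟨k0, by simp only [Finset.mem_filter]; exact ⟨hk0, rfl⟩⟩
  simp only [Finset.mem_filter] at hk1 hmin
  obtain ⟨hk1, hcc⟩ := hk1
  have hq0 : G (i, j, c, a) ≠ 0 := Finsupp.mem_support_iff.mp hk1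
  apply hq0
  have hev : ∀ m : ℕ, (G (i, j, c, a)).eval (((m : ℤ) - a + 2 * a : ℤ) : ℂ) = 0 := by
    intro m
    have h0 := congrArg (fun g : MM => (g (m + a + i - 2 * c) j).coeff c) (hw m a)
    have hψ : ψ G = ∑ k ∈ G.support, mon k.1 k.2.1 k.2.2.1 (G k) k.2.2.2 := by
      simp [ψ, Finsupp.sum, monL_apply]
    simp only [hψ, map_sum, LinearMap.sum_apply, Finset.sum_apply, finsetSum_coeff,
      Pi.zero_apply, coeff_zero, mon_act, coeff_smul] at h0
    rw [Finset.sum_eq_single (i, j, c, a)] at h0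
    · simp only [(oF_pow _ _ (dl_deg _ _) _ _).2, dl_apply] at h0
      rw [if_pos (by constructor <;> ring)] at h0
      simp only [coeff_one_zero, mul_one, smul_eq_mul, mul_eq_zero, Nat.descFactorial_self,
        Nat.cast_eq_zero, Nat.factorial_ne_zero, false_or] at h0
      exact h0.resolve_right (pow_ne_zero _ (by norm_num))
    · rintro ⟨i', j', c', a'⟩ hk hkne
      have hle := hmax _ hk
      simp only at hle hcc hmin ⊢
      rcases lt_or_eq_of_le hle with hlt | heq
      · rw [coeff_eq_zero_of_natDegree_lt, smul_zero]
        exact lt_of_le_of_lt (oF_pow _ _ (dl_deg _ _) _ _).1 (by omega)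
      · have ha := hmin _ ⟨hk, heq⟩
        simp only at ha
        rcases lt_or_eq_of_le ha with hlt | haeq
        · rw [Nat.descFactorial_of_lt hlt]; simp
        · have : c' = c := by omega
          subst this
          subst haeq
          rw [(oF_pow _ _ (dl_deg _ _) _ _).2, dl_apply, if_neg]
          · simp
          · rintro ⟨h1, h2⟩
            apply hkne
            have : i' = i := by omega
            have : j' = j := by omega
            subst_vars; rfl
    · intro h; exact absurd hk1 h
  apply Polynomial.eq_zero_of_infinite_isRoot
  refine Set.Infinite.mono (s := Set.range fun m : ℕ => (((m : ℤ) - a + 2 * a : ℤ) : ℂ)) ?_ ?_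
  · rintro _ ⟨m, rfl⟩; exact hev m
  · apply Set.infinite_range_of_injective
    intro m m' h
    have h' : ((m : ℤ) - a + 2 * a : ℤ) = ((m' : ℤ) - a + 2 * a : ℤ) := Int.cast_injective h
    omega

lemma central_form (z : Hz 0) (hz : ∀ b, b * z = z * b) : ∃ p : ℂ[X], z = aeval tt p := by
  have hc : ∀ b (g : MM), ρ b (ρ z g) = ρ z (ρ b g) := by
    intro b g
    rw [← Module.End.mul_apply, ← Module.End.mul_apply, ← map_mul, ← map_mul, hz]
  set g := ρ z (dl 0 0) with hg
  have h1 : ∀ u v, ((u - v : ℤ) : ℂ[X]) * g u v = 0 := by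
    intro u v
    have := hc (π 0 gh) (dl 0 0)
    rw [ρ_h] at this
    have h2 : oH (dl 0 0) = 0 := by
      have := oH_dl X 0 0
      simpa using this
    rw [h2, map_zero] at this
    exact congrFun (congrFun this u) v
  have h2 : ∀ u v, ((v + 1 : ℤ) : ℂ[X]) * g (u - 1) (v + 1) = 0 := by
    intro u v
    have := hc (π 0 ge) (dl 0 0)
    rw [ρ_e, oE_dl] at this
    simp only [Int.cast_zero, zero_smul, map_zero] at this
    exact congrFun (congrFun this u) v
  have hsupp : ∀ u v, ¬ (u = 0 ∧ v = 0) → g u v = 0 := by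
    intro u v h
    by_cases hv : v = 0
    · refine (mul_eq_zero.mp (h1 u v)).resolve_left ?_
      exact Int.cast_ne_zero.mpr (by omega)
    · have := h2 (u + 1) (v - 1)
      simp only [add_sub_cancel_right, sub_add_cancel] at this
      exact (mul_eq_zero.mp this).resolve_left (Int.cast_ne_zero.mpr hv)
  have dX : ∀ m n, oX (dl m n) = dl (m + 1) n := by
    intro m n; ext1 u; ext1 v
    simp only [oX_apply, dl_apply, sub_eq_iff_eq_add]
  have dY : ∀ m n, oY (dl m n) = dl m (n + 1) := by
    intro m n; ext1 u; ext1 v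
    simp only [oY_apply, dl_apply, sub_eq_iff_eq_add]
  have sX : ∀ m n u v, ρ z (dl (m + 1) n) u v = ρ z (dl m n) (u - 1) v := by
    intro m n u v
    have := hc (π 0 gx) (dl m n)
    rw [ρ_x, dX] at this
    rw [← this, oX_apply]
  have sY : ∀ m n u v, ρ z (dl m (n + 1)) u v = ρ z (dl m n) u (v - 1) := by
    intro m n u v
    have := hc (π 0 gy) (dl m n)
    rw [ρ_y, dY] at this
    rw [← this, oY_apply]
  have tX : ∀ m n u v, ρ z (dl m n) u v = ρ z (dl 0 n) (u - m) v := by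
    intro m n
    induction m using Int.induction_on with
    | zero => simp
    | succ k ih => 
      intro u v
      rw [sX, ih]; congr 1; ring
    | pred k ih =>
      intro u v
      have := sX (-k - 1) n (u + 1) v
      rw [sub_add_cancel, add_sub_cancel_right] at this
      rw [← this, ih]; congr 1; ring
  have tY : ∀ n u v, ρ z (dl 0 n) u v = g u (v - n) := by
    intro n
    induction n using Int.induction_on with
    | zero => simp [hg]
    | succ k ih =>
      intro u v
      rw [sY, ih]; congr 1; ring
    | pred k ih =>
      intro u v
      have := sY 0 (-k - 1) u (v + 1)
      rw [sub_add_cancel, add_sub_cancel_right] at this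
      rw [← this, ih]; congr 1; ring
  refine ⟨g 0 0, ?_⟩
  rw [← sub_eq_zero]
  apply faithful
  intro m n
  ext1 u; ext1 v
  rw [map_sub, LinearMap.sub_apply, Pi.sub_apply, Pi.sub_apply, ρ_aeval_apply, tX, tY, dl_apply]
  by_cases h : u = m ∧ v = n
  · obtain ⟨rfl, rfl⟩ := h
    simp
  · rw [if_neg h, hsupp _ _ (by omega)]; simp

theorem center_H0_polynomial :
    Subalgebra.center ℂ (Hz 0)
      = Algebra.adjoin ℂ
          {π 0 ge * π 0 gy ^ 2 + π 0 gh * π 0 gx * π 0 gy - π 0 gf * π 0 gx ^ 2} ∧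
    Function.Injective
      (Polynomial.aeval
        (π 0 ge * π 0 gy ^ 2 + π 0 gh * π 0 gx * π 0 gy - π 0 gf * π 0 gx ^ 2) :
        Polynomial ℂ →ₐ[ℂ] Hz 0) := by
  change Subalgebra.center ℂ (Hz 0) = Algebra.adjoin ℂ {tt} ∧
    Function.Injective (Polynomial.aeval tt : Polynomial ℂ →ₐ[ℂ] Hz 0)
  constructor
  · apply le_antisymm
    · intro z hz
      rw [Subalgebra.mem_center_iff] at hz
      obtain ⟨p, rfl⟩ := central_form z hz
      exact aeval_mem_adjoin_singleton ℂ tt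
    · rw [Algebra.adjoin_le_iff, Set.singleton_subset_iff, SetLike.mem_coe,
        Subalgebra.mem_center_iff]
      exact tt_comm
  · intro p q hpq
    have hp := ρ_aeval_apply p (dl 0 0) 0 0
    have hq := ρ_aeval_apply q (dl 0 0) 0 0
    rw [hpq, hq] at hp
    simpa [dl_apply] using hp.symm
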